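/- Under Assumption 1.1, for every λ > 0 the Dirichlet resolvent densities converge uniformly: sup_{x,y∈[0,1]} |ρ_λ^D(x,y) − ρ_{λ,n}^D(x,y)| ≤ (2e^λ + 4) λ e^{2λ} ‖F − F_n‖_∞ → 0 as n → ∞. -/

import Mathlib

open MeasureTheory Set Real Filter

noncomputable def genP (μ : Measure ℝ) : ℕ → ℝ → ℝ
  | 0 => fun _ => 1
  | k + 1 => fun x =>
      if Odd (k + 1) then ∫ t in (0:ℝ)..x, genP μ k t ∂μ
      else ∫ t in (0:ℝ)..x, genP μ k t

noncomputable def genQ (μ : Measure ℝ) : ℕ → ℝ → ℝ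
  | 0 => fun _ => 1
  | k + 1 => fun x =>
      if Odd (k + 1) then ∫ t in (0:ℝ)..x, genQ μ k t
      else ∫ t in (0:ℝ)..x, genQ μ k t ∂μ

noncomputable def genCosh (μ : Measure ℝ) (z : ℝ) (x : ℝ) : ℝ :=
  ∑' k : ℕ, z ^ (2 * k) * genP μ (2 * k) x

noncomputable def genSinh (μ : Measure ℝ) (z : ℝ) (x : ℝ) : ℝ :=
  ∑' k : ℕ, z ^ (2 * k + 1) * genQ μ (2 * k + 1) x

/-- sup-distance between distribution functions on [0,1] -/
noncomputable def distSup (μ ν : Measure ℝ) : ℝ :=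
  ⨆ x : Set.Icc (0:ℝ) 1, |(μ (Set.Icc 0 (x:ℝ))).toReal - (ν (Set.Icc 0 (x:ℝ))).toReal|


/-- Dirichlet resolvent density -/
noncomputable def rhoD (μ : Measure ℝ) (l : ℝ) (x y : ℝ) : ℝ :=
  (1 / Real.sqrt l) * genSinh μ (Real.sqrt l) (min x y) * genSinh μ (Real.sqrt l) (1 - max x y)
    / genSinh μ (Real.sqrt l) 1

/-! helper lemmas -/

theorem genQ_odd (μ : Measure ℝ) (k : ℕ) (x : ℝ) :
    genQ μ (2 * k + 1) x = ∫ t in (0:ℝ)..x, genQ μ (2 * k) t := by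
  simp [genQ]

theorem genQ_even (μ : Measure ℝ) (k : ℕ) (x : ℝ) :
    genQ μ (2 * (k + 1)) x = ∫ t in (0:ℝ)..x, genQ μ (2 * k + 1) t ∂μ := by
  have h : ¬ Odd (2 * k + 1 + 1) := by simp [parity_simps]
  rw [show 2 * (k + 1) = 2 * k + 1 + 1 by ring, genQ]; exact if_neg h

theorem genQ_continuous (μ : Measure ℝ) [IsProbabilityMeasure μ] [NullSingletonClass μ] (k : ℕ) :
    Continuous (genQ μ k) := by
  induction k with
  | zero => exact continuous_const
  | succ k ih =>
    by_cases h : Odd (k + 1)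
    · have : genQ μ (k + 1) = fun x => ∫ t in (0:ℝ)..x, genQ μ k t := by
        funext x; rw [genQ]; exact if_pos h
      rw [this]
      exact intervalIntegral.continuous_primitive (fun a b => ih.intervalIntegrable a b) 0
    · have : genQ μ (k + 1) = fun x => ∫ t in (0:ℝ)..x, genQ μ k t ∂μ := by
        funext x; rw [genQ]; exact if_neg h
      rw [this]
      exact intervalIntegral.continuous_primitive (fun a b => ih.intervalIntegrable a b) 0

theorem intmu_le (μ : Measure ℝ) [IsProbabilityMeasure μ] (f : ℝ → ℝ) (x C : ℝ) (hx : 0 ≤ x)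
    (hC : 0 ≤ C) (h : ∀ t ∈ Ioc 0 x, |f t| ≤ C) : |∫ t in (0:ℝ)..x, f t ∂μ| ≤ C := by
  rw [intervalIntegral.integral_of_le hx]
  have := norm_setIntegral_le_of_norm_le_const (μ := μ) (s := Ioc 0 x) (f := f) (C := C)
    (measure_lt_top _ _) (by simpa using h)
  refine this.trans ?_
  have h1 : μ.real (Ioc 0 x) ≤ 1 := measureReal_le_one
  nlinarith

theorem int_pow_div (x : ℝ) (k : ℕ) :
    ∫ t in (0:ℝ)..x, t ^ k / (k.factorial : ℝ) = x ^ (k + 1) / ((k + 1).factorial : ℝ) := by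
  rw [intervalIntegral.integral_div, integral_pow, Nat.factorial_succ]
  have : (k.factorial : ℝ) ≠ 0 := by positivity
  push_cast
  field_simp
  simp

theorem genQ_bounds (μ : Measure ℝ) [IsProbabilityMeasure μ] [NullSingletonClass μ] (k : ℕ) :
    (∀ x, 0 ≤ x → 0 ≤ genQ μ (2 * k) x ∧ genQ μ (2 * k) x ≤ x ^ k / (k.factorial : ℝ)) ∧
    (∀ x, 0 ≤ x → 0 ≤ genQ μ (2 * k + 1) x ∧
      genQ μ (2 * k + 1) x ≤ x ^ (k + 1) / ((k + 1).factorial : ℝ)) := by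
  have step : ∀ k, (∀ x, 0 ≤ x → 0 ≤ genQ μ (2 * k) x ∧
      genQ μ (2 * k) x ≤ x ^ k / (k.factorial : ℝ)) →
      (∀ x, 0 ≤ x → 0 ≤ genQ μ (2 * k + 1) x ∧
      genQ μ (2 * k + 1) x ≤ x ^ (k + 1) / ((k + 1).factorial : ℝ)) := by
    intro k h x hx
    rw [genQ_odd]
    refine ⟨intervalIntegral.integral_nonneg hx fun t ht => (h t ht.1).1, ?_⟩
    rw [← int_pow_div]
    refine intervalIntegral.integral_mono_on hx ((genQ_continuous μ _).intervalIntegrable _ _)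
      (Continuous.intervalIntegrable (by fun_prop) _ _) fun t ht => (h t ht.1).2
  induction k with
  | zero =>
    have h0 : ∀ x, 0 ≤ x → 0 ≤ genQ μ (2 * 0) x ∧
      genQ μ (2 * 0) x ≤ x ^ 0 / ((Nat.factorial 0 : ℕ) : ℝ) := by
      intro x hx; simp [genQ]
    exact ⟨h0, step 0 h0⟩
  | succ k ih =>
    have h0 : ∀ x, 0 ≤ x → 0 ≤ genQ μ (2 * (k + 1)) x ∧
      genQ μ (2 * (k + 1)) x ≤ x ^ (k + 1) / ((k + 1).factorial : ℝ) := by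
      intro x hx
      rw [genQ_even]
      refine ⟨intervalIntegral.integral_nonneg hx fun t ht => (ih.2 t ht.1).1, ?_⟩
      refine (le_abs_self _).trans (intmu_le μ _ x _ hx (by positivity) fun t ht => ?_)
      rw [abs_of_nonneg (ih.2 t ht.1.le).1]
      refine (ih.2 t ht.1.le).2.trans ?_
      have := ht.1.le
      have := ht.2
      gcongr
    exact ⟨h0, step _ h0⟩

theorem fubini_aux (μ : Measure ℝ) [IsProbabilityMeasure μ] (g : ℝ → ℝ) (hg : Continuous g)
    (t : ℝ) (ht : 0 ≤ t) :
    ∫ s in (0:ℝ)..t, (∫ u in (0:ℝ)..s, g u) ∂μ = ∫ u in (0:ℝ)..t, g u * μ.real (Icc u t) := by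
  have hint : Integrable (Function.uncurry fun s u : ℝ => if u ≤ s then g u else 0)
      ((μ.restrict (Ioc 0 t)).prod (volume.restrict (Ioc 0 t))) := by
    obtain ⟨C, hC⟩ := (isCompact_Icc (a := (0:ℝ)) (b := t)).exists_bound_of_continuousOn
      hg.continuousOn
    have hm : Measurable (Function.uncurry fun s u : ℝ => if u ≤ s then g u else 0) := by
      apply Measurable.ite (measurableSet_le measurable_snd measurable_fst)
      · exact hg.measurable.comp measurable_snd
      · exact measurable_const
    refine Integrable.of_bound hm.aestronglyMeasurable (|C|) ?_
    rw [Measure.prod_restrict]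
    refine (ae_restrict_iff' (measurableSet_Ioc.prod measurableSet_Ioc)).2 (ae_of_all _ ?_)
    rintro ⟨s, u⟩ ⟨hs, hu⟩
    simp only [Function.uncurry]
    split_ifs
    · exact (hC u ⟨hu.1.le, hu.2⟩).trans (le_abs_self _)
    · simp
  have sw := integral_integral_swap hint
  rw [intervalIntegral.integral_of_le ht, intervalIntegral.integral_of_le ht]
  convert sw using 1
  · refine setIntegral_congr_fun measurableSet_Ioc fun s hs => ?_
    rw [intervalIntegral.integral_of_le hs.1.le]
    have : (fun u => if u ≤ s then g u else 0) = indicator (Iic s) g := by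
      funext u; simp [indicator]
    rw [this, integral_indicator measurableSet_Iic, Measure.restrict_restrict measurableSet_Iic]
    congr 2
    ext u; simp only [mem_Ioc, mem_inter_iff, mem_Iic]
    have := hs.2
    grind
  · refine setIntegral_congr_fun measurableSet_Ioc fun u hu => ?_
    have : (fun s => if u ≤ s then g u else 0) = indicator (Ici u) (fun _ => g u) := by
      funext s; simp [indicator]
    rw [this, integral_indicator measurableSet_Ici, Measure.restrict_restrict measurableSet_Ici]
    have h2 : Ici u ∩ Ioc 0 t = Icc u t := by
      ext s; simp only [mem_Ioc, mem_inter_iff, mem_Ici, mem_Icc]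
      have := hu.1
      grind
    rw [h2, setIntegral_const, smul_eq_mul, mul_comm]

theorem distSup_bdd (μ ν : Measure ℝ) [IsProbabilityMeasure μ] [IsProbabilityMeasure ν] :
    BddAbove (Set.range fun x : Set.Icc (0:ℝ) 1 =>
      |(μ (Set.Icc 0 (x:ℝ))).toReal - (ν (Set.Icc 0 (x:ℝ))).toReal|) := by
  refine ⟨1, ?_⟩
  rintro _ ⟨x, rfl⟩
  have h1 : μ.real (Icc 0 (x:ℝ)) ≤ 1 := measureReal_le_one
  have h2 : ν.real (Icc 0 (x:ℝ)) ≤ 1 := measureReal_le_one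
  have h3 : 0 ≤ μ.real (Icc 0 (x:ℝ)) := measureReal_nonneg
  have h4 : 0 ≤ ν.real (Icc 0 (x:ℝ)) := measureReal_nonneg
  simp only [Measure.real] at *
  rw [abs_le]; constructor <;> linarith

theorem le_distSup (μ ν : Measure ℝ) [IsProbabilityMeasure μ] [IsProbabilityMeasure ν]
    (x : ℝ) (hx : x ∈ Icc (0:ℝ) 1) : |μ.real (Icc 0 x) - ν.real (Icc 0 x)| ≤ distSup μ ν :=
  le_ciSup (distSup_bdd μ ν) ⟨x, hx⟩

theorem distSup_nonneg (μ ν : Measure ℝ) [IsProbabilityMeasure μ] [IsProbabilityMeasure ν] :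
    0 ≤ distSup μ ν :=
  (abs_nonneg _).trans (le_distSup μ ν 0 (by simp))

theorem real_Icc (μ : Measure ℝ) [IsProbabilityMeasure μ] [NullSingletonClass μ] (u t : ℝ)
    (hu : 0 ≤ u) (hut : u ≤ t) :
    μ.real (Icc u t) = μ.real (Icc 0 t) - μ.real (Icc 0 u) := by
  have h1 : μ.real (Ico 0 u) = μ.real (Icc 0 u) := measureReal_congr Ico_ae_eq_Icc
  have h2 : μ.real (Ico 0 u ∪ Icc u t) = μ.real (Ico 0 u) + μ.real (Icc u t) := by
    apply measureReal_union _ measurableSet_Icc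
    rw [Set.disjoint_left]; intro a ha hb; exact absurd ha.2 (not_lt.2 hb.1)
  rw [Ico_union_Icc_eq_Icc hu hut] at h2
  linarith

theorem real_Icc_diff (μ ν : Measure ℝ) [IsProbabilityMeasure μ] [NullSingletonClass μ]
    [IsProbabilityMeasure ν] [NullSingletonClass ν] (u t : ℝ) (hu : 0 ≤ u) (hut : u ≤ t) (ht : t ≤ 1) :
    |μ.real (Icc u t) - ν.real (Icc u t)| ≤ 2 * distSup μ ν := by
  rw [real_Icc μ u t hu hut, real_Icc ν u t hu hut]
  have h1 := abs_le.1 (le_distSup μ ν u ⟨hu, hut.trans ht⟩)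
  have h2 := abs_le.1 (le_distSup μ ν t ⟨hu.trans hut, ht⟩)
  rw [abs_le]; constructor <;> linarith [h1.1, h1.2, h2.1, h2.2]

theorem genQ_diff (μ ν : Measure ℝ) [IsProbabilityMeasure μ] [NullSingletonClass μ]
    [IsProbabilityMeasure ν] [NullSingletonClass ν] (k : ℕ) :
    ∀ x ∈ Icc (0:ℝ) 1, |genQ μ (2 * k + 1) x - genQ ν (2 * k + 1) x| ≤
      2 * distSup μ ν * (k * (x ^ k / (k.factorial : ℝ))) := by
  have hD := distSup_nonneg μ ν
  induction k with
  | zero => intro x hx; simp [genQ]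
  | succ k ih =>
    have key : ∀ t ∈ Icc (0:ℝ) 1, |genQ μ (2 * (k + 1)) t - genQ ν (2 * (k + 1)) t| ≤
        2 * distSup μ ν * ((k + 1) * (t ^ k / (k.factorial : ℝ))) := by
      intro t ht
      have hq := genQ_continuous μ (2 * k)
      have e1 : ∀ (ρ : Measure ℝ) [IsProbabilityMeasure ρ],
          ∫ s in (0:ℝ)..t, genQ μ (2 * k + 1) s ∂ρ
          = ∫ u in (0:ℝ)..t, genQ μ (2 * k) u * ρ.real (Icc u t) := by
        intro ρ _
        rw [← fubini_aux ρ _ hq t ht.1]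
        simp_rw [genQ_odd]
      have mono : ∀ (ρ : Measure ℝ) [IsProbabilityMeasure ρ],
          IntervalIntegrable (fun u => genQ μ (2 * k) u * ρ.real (Icc u t)) volume 0 t := by
        intro ρ _
        have ha : Antitone fun u => ρ.real (Icc u t) := fun a b hab =>
          measureReal_mono (Icc_subset_Icc_left hab)
        exact ha.intervalIntegrable.continuousOn_mul hq.continuousOn
      have p1 : |∫ s in (0:ℝ)..t, genQ μ (2 * k + 1) s ∂μ
          - ∫ s in (0:ℝ)..t, genQ μ (2 * k + 1) s ∂ν| ≤
          2 * distSup μ ν * (t ^ (k + 1) / ((k + 1).factorial : ℝ)) := by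
        rw [e1 μ, e1 ν, ← intervalIntegral.integral_sub (mono μ) (mono ν)]
        calc _ ≤ ∫ u in (0:ℝ)..t, 2 * distSup μ ν * genQ μ (2 * k) u := by
              rw [← Real.norm_eq_abs]
              refine intervalIntegral.norm_integral_le_of_norm_le (μ := volume) ht.1 (ae_of_all _ fun u hu => ?_)
                ((hq.const_mul (2 * distSup μ ν)).intervalIntegrable _ _)
              rw [← mul_sub, norm_mul, mul_comm (2 * _)]
              have h0 := ((genQ_bounds μ k).1 u hu.1.le).1
              rw [Real.norm_of_nonneg h0]
              exact mul_le_mul_of_nonneg_left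
                (real_Icc_diff μ ν u t hu.1.le hu.2 ht.2) h0
          _ = 2 * distSup μ ν * genQ μ (2 * k + 1) t := by
              rw [intervalIntegral.integral_const_mul, genQ_odd]
          _ ≤ _ := mul_le_mul_of_nonneg_left ((genQ_bounds μ k).2 t ht.1).2 (by positivity)
      have p2 : |∫ s in (0:ℝ)..t, (genQ μ (2 * k + 1) s - genQ ν (2 * k + 1) s) ∂ν| ≤
          2 * distSup μ ν * (k * (t ^ k / (k.factorial : ℝ))) := by
        have := ht.1
        refine intmu_le ν _ t _ ht.1 (by positivity) fun s hs => ?_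
        refine (ih s ⟨hs.1.le, hs.2.trans ht.2⟩).trans ?_
        have := hs.1.le
        have := hs.2
        gcongr
      rw [intervalIntegral.integral_sub ((genQ_continuous μ _).intervalIntegrable _ _)
        ((genQ_continuous ν _).intervalIntegrable _ _)] at p2
      rw [genQ_even, genQ_even]
      have p3 : t ^ (k + 1) / ((k + 1).factorial : ℝ) ≤ t ^ k / (k.factorial : ℝ) := by
        have := ht.1
        have h1 : t ^ (k + 1) ≤ t ^ k := pow_le_pow_of_le_one ht.1 ht.2 (Nat.le_succ k)
        have h2 : (k.factorial : ℝ) ≤ ((k + 1).factorial : ℝ) := by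
          exact_mod_cast Nat.factorial_le (Nat.le_succ k)
        gcongr
      have p4 := mul_le_mul_of_nonneg_left p3 (mul_nonneg (zero_le_two (α := ℝ)) hD)
      have a1 := abs_le.1 p1
      have a2 := abs_le.1 p2
      rw [abs_le]
      constructor <;> linarith [a1.1, a1.2, a2.1, a2.2]
    intro x hx
    rw [genQ_odd, genQ_odd, ← intervalIntegral.integral_sub
      ((genQ_continuous μ _).intervalIntegrable _ _) ((genQ_continuous ν _).intervalIntegrable _ _)]
    calc _ ≤ ∫ t in (0:ℝ)..x, 2 * distSup μ ν * ((k + 1) * (t ^ k / (k.factorial : ℝ))) := by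
          rw [← Real.norm_eq_abs]
          refine intervalIntegral.norm_integral_le_of_norm_le (μ := volume) hx.1 (ae_of_all _ fun u hu => ?_)
            (Continuous.intervalIntegrable (u := fun t : ℝ =>
              2 * distSup μ ν * ((k + 1) * (t ^ k / (k.factorial : ℝ)))) (by fun_prop) _ _)
          exact key u ⟨hu.1.le, hu.2.trans hx.2⟩
      _ = _ := by
          rw [intervalIntegral.integral_const_mul, intervalIntegral.integral_const_mul, int_pow_div]
          push_cast; rfl

theorem hasSum_exp_l (l : ℝ) : HasSum (fun k : ℕ => l ^ k / (k.factorial : ℝ)) (Real.exp l) := by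
  rw [Real.exp_eq_exp_ℝ]; exact NormedSpace.expSeries_div_hasSum_exp l

theorem sqrt_pow_odd (l : ℝ) (hl : 0 < l) (k : ℕ) :
    Real.sqrt l ^ (2 * k + 1) = Real.sqrt l * l ^ k := by
  rw [pow_succ, pow_mul, Real.sq_sqrt hl.le, mul_comm]

theorem term_bounds (μ : Measure ℝ) [IsProbabilityMeasure μ] [NullSingletonClass μ] (l : ℝ) (hl : 0 < l)
    (x : ℝ) (hx : x ∈ Icc (0:ℝ) 1) (k : ℕ) :
    0 ≤ Real.sqrt l ^ (2 * k + 1) * genQ μ (2 * k + 1) x ∧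
    Real.sqrt l ^ (2 * k + 1) * genQ μ (2 * k + 1) x ≤
      Real.sqrt l * (l ^ k / (k.factorial : ℝ)) := by
  obtain ⟨h0, h1⟩ := (genQ_bounds μ k).2 x hx.1
  refine ⟨by positivity, ?_⟩
  have h2 : (k.factorial : ℝ) ≤ ((k + 1).factorial : ℝ) := by
    exact_mod_cast Nat.factorial_le (Nat.le_succ k)
  have h3 : x ^ (k + 1) ≤ 1 := pow_le_one₀ hx.1 hx.2
  have h4 : genQ μ (2 * k + 1) x ≤ 1 / (k.factorial : ℝ) := h1.trans (by gcongr)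
  rw [sqrt_pow_odd l hl, mul_assoc, div_eq_mul_one_div (l ^ k)]
  gcongr

theorem sinh_summable (μ : Measure ℝ) [IsProbabilityMeasure μ] [NullSingletonClass μ] (l : ℝ) (hl : 0 < l)
    (x : ℝ) (hx : x ∈ Icc (0:ℝ) 1) :
    Summable fun k : ℕ => Real.sqrt l ^ (2 * k + 1) * genQ μ (2 * k + 1) x :=
  Summable.of_nonneg_of_le (fun k => (term_bounds μ l hl x hx k).1)
    (fun k => (term_bounds μ l hl x hx k).2) ((hasSum_exp_l l).mul_left _).summable

theorem sinh_nonneg (μ : Measure ℝ) [IsProbabilityMeasure μ] [NullSingletonClass μ] (l : ℝ) (hl : 0 < l)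
    (x : ℝ) (hx : x ∈ Icc (0:ℝ) 1) : 0 ≤ genSinh μ (Real.sqrt l) x :=
  tsum_nonneg fun k => (term_bounds μ l hl x hx k).1

theorem sinh_le (μ : Measure ℝ) [IsProbabilityMeasure μ] [NullSingletonClass μ] (l : ℝ) (hl : 0 < l)
    (x : ℝ) (hx : x ∈ Icc (0:ℝ) 1) :
    genSinh μ (Real.sqrt l) x ≤ Real.sqrt l * Real.exp l :=
  hasSum_le (fun k => (term_bounds μ l hl x hx k).2) (sinh_summable μ l hl x hx).hasSum
    ((hasSum_exp_l l).mul_left _)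

theorem le_sinh_one (μ : Measure ℝ) [IsProbabilityMeasure μ] [NullSingletonClass μ] (l : ℝ) (hl : 0 < l) :
    Real.sqrt l ≤ genSinh μ (Real.sqrt l) 1 := by
  have h1 : (1:ℝ) ∈ Icc (0:ℝ) 1 := by simp
  have := (sinh_summable μ l hl 1 h1).le_tsum 0 fun k _ => (term_bounds μ l hl 1 h1 k).1
  have h2 : Real.sqrt l ^ (2 * 0 + 1) * genQ μ (2 * 0 + 1) 1 = Real.sqrt l := by simp [genQ]
  rw [h2] at this
  exact this

theorem sinh_diff (μ ν : Measure ℝ) [IsProbabilityMeasure μ] [NullSingletonClass μ]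
    [IsProbabilityMeasure ν] [NullSingletonClass ν] (l : ℝ) (hl : 0 < l) (x : ℝ) (hx : x ∈ Icc (0:ℝ) 1) :
    |genSinh μ (Real.sqrt l) x - genSinh ν (Real.sqrt l) x| ≤
      2 * (Real.sqrt l * l) * Real.exp l * distSup μ ν := by
  have hD := distSup_nonneg μ ν
  have hs : HasSum (fun k : ℕ => 2 * Real.sqrt l * distSup μ ν * (k * (l ^ k / (k.factorial : ℝ))))
      (2 * (Real.sqrt l * l) * Real.exp l * distSup μ ν) := by
    have : HasSum (fun k : ℕ => (k * (l ^ k / (k.factorial : ℝ)))) (l * Real.exp l) := by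
      rw [← hasSum_nat_add_iff' 1]
      simp only [Finset.sum_range_one, Nat.cast_zero, zero_mul, sub_zero]
      suffices h6 : (fun k : ℕ => ((k + 1 : ℕ) : ℝ) * (l ^ (k + 1) / ((k + 1).factorial : ℝ))) =
          fun k : ℕ => l * (l ^ k / (k.factorial : ℝ))  from by
        rw [h6]; exact (hasSum_exp_l l).mul_left l
      funext k
      rw [Nat.factorial_succ]
      push_cast
      have : (k.factorial : ℝ) ≠ 0 := by positivity
      field_simp
      ring
    have h5 : 2 * (Real.sqrt l * l) * Real.exp l * distSup μ ν =
        2 * Real.sqrt l * distSup μ ν * (l * Real.exp l) := by ring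
    rw [h5]
    exact this.mul_left (2 * Real.sqrt l * distSup μ ν)
  have hsub := (sinh_summable μ l hl x hx).hasSum.sub (sinh_summable ν l hl x hx).hasSum
  have hb : ∀ k : ℕ, ‖Real.sqrt l ^ (2 * k + 1) * genQ μ (2 * k + 1) x
      - Real.sqrt l ^ (2 * k + 1) * genQ ν (2 * k + 1) x‖ ≤
      2 * Real.sqrt l * distSup μ ν * (k * (l ^ k / (k.factorial : ℝ))) := by
    intro k
    rw [← mul_sub, norm_mul, Real.norm_of_nonneg (by positivity), sqrt_pow_odd l hl]
    have h1 := genQ_diff μ ν k x hx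
    have h3 : x ^ k ≤ 1 := pow_le_one₀ hx.1 hx.2
    have h2 : |genQ μ (2 * k + 1) x - genQ ν (2 * k + 1) x| ≤
      2 * distSup μ ν * (k * (1 / (k.factorial : ℝ))) := h1.trans (by gcongr)
    calc _ ≤ Real.sqrt l * l ^ k * (2 * distSup μ ν * (k * (1 / (k.factorial : ℝ)))) :=
          mul_le_mul_of_nonneg_left h2 (by positivity)
      _ = _ := by ring
  have := tsum_of_norm_bounded hs hb
  rw [hsub.tsum_eq] at this
  exact this

theorem rhoD_diff (μ ν : Measure ℝ) [IsProbabilityMeasure μ] [NullSingletonClass μ]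
    [IsProbabilityMeasure ν] [NullSingletonClass ν] (l : ℝ) (hl : 0 < l) (x : ℝ) (hx : x ∈ Icc (0:ℝ) 1)
    (y : ℝ) (hy : y ∈ Icc (0:ℝ) 1) :
    |rhoD μ l x y - rhoD ν l x y|
        ≤ (2 * Real.exp l + 4) * l * Real.exp (2 * l) * distSup μ ν := by
  have hm : min x y ∈ Icc (0:ℝ) 1 := ⟨le_min hx.1 hy.1, (min_le_left _ _).trans hx.2⟩
  have hM : 1 - max x y ∈ Icc (0:ℝ) 1 :=
    ⟨sub_nonneg.2 (max_le hx.2 hy.2), by linarith [hx.1.trans (le_max_left x y)]⟩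
  have h1 : (1:ℝ) ∈ Icc (0:ℝ) 1 := by simp
  have hD := distSup_nonneg μ ν
  have hs : 0 < Real.sqrt l := Real.sqrt_pos.2 hl
  have hsq : Real.sqrt l * Real.sqrt l = l := Real.mul_self_sqrt hl.le
  unfold rhoD
  have a0 := sinh_nonneg μ l hl _ hm
  have a1 := sinh_le μ l hl _ hm
  have b0 := sinh_nonneg μ l hl _ hM
  have b1 := sinh_le μ l hl _ hM
  have a0' := sinh_nonneg ν l hl _ hm
  have a1' := sinh_le ν l hl _ hm
  have c1 := le_sinh_one μ l hl
  have c1' := le_sinh_one ν l hl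
  have da := sinh_diff μ ν l hl _ hm
  have db := sinh_diff μ ν l hl _ hM
  have dc := sinh_diff μ ν l hl _ h1
  rw [abs_sub_comm] at dc
  have e2 : Real.exp (2 * l) = Real.exp l * Real.exp l := by rw [← Real.exp_add]; ring_nf
  rw [e2]
  have hE := Real.exp_pos l
  generalize Real.exp l = E at *
  generalize genSinh μ (Real.sqrt l) (min x y) = a at *
  generalize genSinh ν (Real.sqrt l) (min x y) = a' at *
  generalize genSinh μ (Real.sqrt l) (1 - max x y) = b at *
  generalize genSinh ν (Real.sqrt l) (1 - max x y) = b' at *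
  generalize genSinh μ (Real.sqrt l) 1 = c at *
  generalize genSinh ν (Real.sqrt l) 1 = c' at *
  generalize distSup μ ν = D at *
  generalize Real.sqrt l = s at *
  subst hsq
  have hc : 0 < c := hs.trans_le c1
  have hc' : 0 < c' := hs.trans_le c1'
  have id : 1 / s * a * b / c - 1 / s * a' * b' / c' =
      1 / s * (a * b * (c' - c) / (c * c') + ((a - a') * b + a' * (b - b')) / c') := by
    field_simp
    ring
  rw [id, abs_mul, abs_of_pos (by positivity : 0 < 1 / s)]
  have t1 : |a * b * (c' - c) / (c * c')| ≤
      ((s * E) * (s * E) * (2 * (s * (s * s)) * E * D)) / (s * s) := by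
    rw [abs_div, abs_mul, abs_of_nonneg (mul_nonneg a0 b0), abs_of_pos (mul_pos hc hc')]
    gcongr
  have t2 : |((a - a') * b + a' * (b - b')) / c'| ≤
      ((2 * (s * (s * s)) * E * D) * (s * E) + (s * E) * (2 * (s * (s * s)) * E * D)) / s := by
    rw [abs_div, abs_of_pos hc']
    gcongr
    refine (abs_add_le _ _).trans ?_
    rw [abs_mul, abs_mul, abs_of_nonneg b0, abs_of_nonneg a0']
    gcongr
  calc _ ≤ 1 / s * (((s * E) * (s * E) * (2 * (s * (s * s)) * E * D)) / (s * s) +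
      ((2 * (s * (s * s)) * E * D) * (s * E) + (s * E) * (2 * (s * (s * s)) * E * D)) / s) := by
        gcongr
        exact (abs_add_le _ _).trans (add_le_add t1 t2)
    _ = _ := by field_simp; ring

theorem distSup_tendsto (μ : Measure ℝ) (μn : ℕ → Measure ℝ)
    [IsProbabilityMeasure μ] [∀ n, IsProbabilityMeasure (μn n)]
    (hμs : μ (Set.Icc (0:ℝ) 1)ᶜ = 0) (hns : ∀ n, μn n (Set.Icc (0:ℝ) 1)ᶜ = 0)
    (hna : ∀ x : ℝ, μ {x} = 0)
    (hweak : ∀ f : ℝ → ℝ, Continuous f →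
      Tendsto (fun n => ∫ x, f x ∂(μn n)) atTop (nhds (∫ x, f x ∂μ)))
    (ε : ℝ) (hε : 0 < ε) : ∃ N : ℕ, ∀ n ≥ N, distSup μ (μn n) ≤ ε := by
  let P : ProbabilityMeasure ℝ := ⟨μ, inferInstance⟩
  let Pn : ℕ → ProbabilityMeasure ℝ := fun n => ⟨μn n, inferInstance⟩
  have hw : Tendsto Pn atTop (nhds P) := by
    rw [ProbabilityMeasure.tendsto_iff_forall_integral_tendsto]
    intro f
    exact hweak f f.continuous
  have hpt : ∀ x, Tendsto (fun n => (μn n).real (Iic x)) atTop (nhds (μ.real (Iic x))) := by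
    intro x
    have := ProbabilityMeasure.tendsto_measure_of_null_frontier_of_tendsto' hw (E := Iic x)
      (by rw [frontier_Iic]; exact hna x)
    exact (ENNReal.tendsto_toReal (measure_ne_top _ _)).comp this
  have hmono : ∀ (ρ : Measure ℝ) [IsProbabilityMeasure ρ], Monotone fun x => ρ.real (Iic x) :=
    fun ρ _ a b hab => measureReal_mono (Iic_subset_Iic.2 hab)
  have hcont : Continuous fun x => μ.real (Iic x) := by
    rw [continuous_iff_continuousAt]
    intro x
    have hf : (fun x => μ.real (Iic x)) = ProbabilityTheory.cdf μ := by
      funext x; rw [ProbabilityTheory.cdf_eq_real]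
    rw [hf, (ProbabilityTheory.cdf μ).mono.continuousAt_iff_leftLim_eq_rightLim,
      (ProbabilityTheory.cdf μ).rightLim_eq]
    have h := (ProbabilityTheory.cdf μ).measure_singleton x
    rw [ProbabilityTheory.measure_cdf, hna, eq_comm, ENNReal.ofReal_eq_zero] at h
    exact le_antisymm ((ProbabilityTheory.cdf μ).mono.leftLim_le le_rfl) (by linarith)
  have hloc : TendstoLocallyUniformlyOn (fun n x => (μn n).real (Iic x))
      (fun x => μ.real (Iic x)) atTop (Icc (0:ℝ) 1) := by
    rw [Metric.tendstoLocallyUniformlyOn_iff]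
    intro δ hδ x _
    obtain ⟨r, hr, hball⟩ := Metric.continuousAt_iff.1 hcont.continuousAt (δ / 4) (by positivity)
    have ha : |μ.real (Iic (x - r / 2)) - μ.real (Iic x)| < δ / 4 := by
      apply hball; rw [Real.dist_eq, abs_lt]; constructor <;> linarith
    have hb : |μ.real (Iic (x + r / 2)) - μ.real (Iic x)| < δ / 4 := by
      apply hball; rw [Real.dist_eq, abs_lt]; constructor <;> linarith
    refine ⟨Icc (x - r / 2) (x + r / 2),
      mem_nhdsWithin_of_mem_nhds (Icc_mem_nhds (by linarith) (by linarith)), ?_⟩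
    filter_upwards [Metric.tendsto_nhds.1 (hpt (x - r / 2)) (δ / 4) (by positivity),
      Metric.tendsto_nhds.1 (hpt (x + r / 2)) (δ / 4) (by positivity)] with n h1 h2 y hy
    rw [Real.dist_eq] at h1 h2 ⊢
    have m1 : μ.real (Iic (x - r / 2)) ≤ μ.real (Iic y) := hmono μ hy.1
    have m2 : μ.real (Iic y) ≤ μ.real (Iic (x + r / 2)) := hmono μ hy.2
    have m3 : (μn n).real (Iic (x - r / 2)) ≤ (μn n).real (Iic y) := hmono (μn n) hy.1
    have m4 : (μn n).real (Iic y) ≤ (μn n).real (Iic (x + r / 2)) := hmono (μn n) hy.2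
    rw [abs_lt] at *
    obtain ⟨_, _⟩ := ha
    obtain ⟨_, _⟩ := hb
    obtain ⟨_, _⟩ := h1
    obtain ⟨_, _⟩ := h2
    constructor <;> linarith
  rw [tendstoLocallyUniformlyOn_iff_tendstoUniformlyOn_of_compact isCompact_Icc,
    Metric.tendstoUniformlyOn_iff] at hloc
  obtain ⟨N, hN⟩ := eventually_atTop.1 (hloc ε hε)
  refine ⟨N, fun n hn => ?_⟩
  have hI : ∀ (ρ : Measure ℝ), ρ (Set.Icc (0:ℝ) 1)ᶜ = 0 → ∀ x : ℝ,
      ρ (Icc 0 x) = ρ (Iic x) := by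
    intro ρ hρ x
    refine le_antisymm (measure_mono Icc_subset_Iic_self) ?_
    have hsub : Iic x ⊆ Icc 0 x ∪ (Icc (0:ℝ) 1)ᶜ := by
      intro z hz
      by_cases h0 : 0 ≤ z
      · exact Or.inl ⟨h0, hz⟩
      · exact Or.inr fun h => h0 h.1
    calc ρ (Iic x) ≤ ρ (Icc 0 x ∪ (Icc (0:ℝ) 1)ᶜ) := measure_mono hsub
      _ ≤ ρ (Icc 0 x) + ρ (Icc (0:ℝ) 1)ᶜ := measure_union_le _ _
      _ = ρ (Icc 0 x) := by rw [hρ, add_zero]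
  have : Nonempty (Icc (0:ℝ) 1) := ⟨⟨0, by simp⟩⟩
  refine ciSup_le fun x => ?_
  rw [hI μ hμs, hI (μn n) (hns n)]
  exact (hN n hn x x.2).le

theorem stmt_17 (μ : Measure ℝ) (μn : ℕ → Measure ℝ)
    [IsProbabilityMeasure μ] [∀ n, IsProbabilityMeasure (μn n)]
    (hμs : μ (Set.Icc (0:ℝ) 1)ᶜ = 0) (hns : ∀ n, μn n (Set.Icc (0:ℝ) 1)ᶜ = 0)
    (hna : ∀ x : ℝ, μ {x} = 0) (hnan : ∀ n, ∀ x : ℝ, μn n {x} = 0)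
    (hsupp0 : ∀ ε > (0:ℝ), 0 < μ (Set.Icc 0 ε)) (hsupp1 : ∀ ε > (0:ℝ), 0 < μ (Set.Icc (1 - ε) 1))
    (hsupp0n : ∀ n, ∀ ε > (0:ℝ), 0 < μn n (Set.Icc 0 ε))
    (hsupp1n : ∀ n, ∀ ε > (0:ℝ), 0 < μn n (Set.Icc (1 - ε) 1))
    (hweak : ∀ f : ℝ → ℝ, Continuous f →
      Tendsto (fun n => ∫ x, f x ∂(μn n)) atTop (nhds (∫ x, f x ∂μ)))
    (l : ℝ) (hl : 0 < l) :
    (∀ n : ℕ, ∀ x ∈ Set.Icc (0:ℝ) 1, ∀ y ∈ Set.Icc (0:ℝ) 1,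
      |rhoD μ l x y - rhoD (μn n) l x y|
        ≤ (2 * Real.exp l + 4) * l * Real.exp (2 * l) * distSup μ (μn n)) ∧
    (∀ ε > (0:ℝ), ∃ N : ℕ, ∀ n ≥ N, ∀ x ∈ Set.Icc (0:ℝ) 1, ∀ y ∈ Set.Icc (0:ℝ) 1,
      |rhoD μ l x y - rhoD (μn n) l x y| < ε) := by
  have : NullSingletonClass μ := ⟨hna⟩
  have : ∀ n, NullSingletonClass (μn n) := fun n => ⟨hnan n⟩
  have main : ∀ n : ℕ, ∀ x ∈ Set.Icc (0:ℝ) 1, ∀ y ∈ Set.Icc (0:ℝ) 1,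
      |rhoD μ l x y - rhoD (μn n) l x y|
        ≤ (2 * Real.exp l + 4) * l * Real.exp (2 * l) * distSup μ (μn n) :=
    fun n x hx y hy => rhoD_diff μ (μn n) l hl x hx y hy
  refine ⟨main, fun ε hε => ?_⟩
  have hK : 0 < (2 * Real.exp l + 4) * l * Real.exp (2 * l) := by positivity
  obtain ⟨N, hN⟩ := distSup_tendsto μ μn hμs hns hna hweak
    (ε / 2 / ((2 * Real.exp l + 4) * l * Real.exp (2 * l))) (by positivity)
  refine ⟨N, fun n hn x hx y hy => ?_⟩
  have h1 := mul_le_mul_of_nonneg_left (hN n hn) hK.le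
  rw [mul_div_cancel₀ _ hK.ne'] at h1
  linarith [main n x hx y hy]
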